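/- Let W be a suitable basis of A at {β₁,…,β_I}, and let e ∈ C[x] and M ∈ C[x]^{r×r} be such that SW = (1/e)·MW and the gcd of e together with all entries of M equals 1. Let h = (1/ũ)·cW with c = (c₁,…,c_r) ∈ C[x]^r and ũ ∈ C[x] nonzero such that gcd(ũ, c₁, …, c_r) = 1 and the polynomial ũ·∏_{i=1}^I (x−β_i) ∈ C̄[x] is shift-free. If h is summable in A, then ũ divides e and h = Δ(bW) for some b ∈ C[x]^r. -/

import Mathlib

set_option maxHeartbeats 1000000
set_option synthInstance.maxHeartbeats 200000

open Polynomial Filter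

noncomputable section

namespace PRec

variable (C : Type*) [Field C] [CharZero C]

/-- The algebraic closure of the coefficient field. -/
abbrev Cbar := AlgebraicClosure C

/-- The field of formal Laurent series over the algebraic closure. -/
abbrev LS := LaurentSeries (Cbar C)

/-- The Laurent-series variable `q`. -/
def qv : LS C := HahnSeries.single 1 1

open Classical in
/-- The valuation `ν_q`, with `ν_q 0 = ⊤`, valued in the extended reals. -/
def nuq (a : LS C) : EReal := if a = 0 then ⊤ else (((a.order : ℤ) : ℝ) : EReal)

/-- Evaluation of a rational function at the point `α + m + q`. -/
def evalAt (α : Cbar C) (m : ℤ) (p : RatFunc C) : LS C :=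
  RatFunc.eval ((algebraMap (Cbar C) (LS C)).comp (algebraMap C (Cbar C)))
    (algebraMap (Cbar C) (LS C) α + (m : LS C) + qv C) p

/-- Shorthand for the canonical map `C[x] → C(x)`. -/
abbrev toRat : Polynomial C →+* RatFunc C := algebraMap (Polynomial C) (RatFunc C)

variable (ℓ : ℕ → Polynomial C) (r : ℕ)

/-- The solution space `Sol_α(L)` of `L = ℓ₀ + ℓ₁ S + ⋯ + ℓ_r S^r` at `α`,
indexed so that `b n` stands for the value of the solution at `α + n`. -/
def SolSet (α : Cbar C) : Set (ℤ → LS C) :=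
  {b | ∀ n : ℤ, ∑ i ∈ Finset.range (r + 1),
      evalAt C α n (toRat C (ℓ i)) * b (n + i) = 0}

/-- The action of an element `f = f₀ + f₁ S + ⋯ + f_{r-1} S^{r-1}` of
`A = C(x)[S]/⟨L⟩` (represented by its coefficient vector) on a sequence. -/
def elemApply (α : Cbar C) (f : Fin r → RatFunc C) (b : ℤ → LS C) : ℤ → LS C :=
  fun n => ∑ i : Fin r, evalAt C α n (f i) * b (n + (i : ℤ))

/-- Truncated subtraction on extended reals with the convention `⊤ - ⊤ = ⊤`. -/
def esub (a b : EReal) : EReal := if b = ⊤ then ⊤ else a - b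

/-- The value function `val_α` on `A`. -/
def valAt (α : Cbar C) (f : Fin r → RatFunc C) : EReal :=
  ⨅ b ∈ SolSet C ℓ r α,
    esub (nuq C (elemApply C r α f b 0))
      (Filter.liminf (fun n : ℕ => nuq C (b (-(n : ℤ)))) Filter.atTop)

/-- `f ∈ A` is (locally) integral at `α`. -/
def IntegralAt (α : Cbar C) (f : Fin r → RatFunc C) : Prop :=
  0 ≤ valAt C ℓ r α f

/-- Membership in the local subring `C(x)_α` of rational functions having no pole at `α`. -/
def InLocalRing (α : Cbar C) (f : RatFunc C) : Prop :=
  ∃ p q : Polynomial C, (Polynomial.aeval α) q ≠ 0 ∧ f = toRat C p / toRat C q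

/-- `W` is a `C(x)`-vector space basis of `A` (represented on coefficient vectors). -/
def IsVSBasis (W : Fin r → (Fin r → RatFunc C)) : Prop :=
  LinearIndependent (RatFunc C) W ∧
    Submodule.span (RatFunc C) (Set.range W) = (⊤ : Submodule (RatFunc C) (Fin r → RatFunc C))

/-- The `C(x)_α`-span of a tuple of elements of `A`. -/
def localSpan (α : Cbar C) (W : Fin r → (Fin r → RatFunc C)) :
    Set (Fin r → RatFunc C) :=
  {f | ∃ c : Fin r → RatFunc C, (∀ i, InLocalRing C α (c i)) ∧ f = ∑ i, c i • W i}

/-- `W` is a local integral basis of `A` at `α`. -/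
def IsLocalIntegralBasis (α : Cbar C) (W : Fin r → (Fin r → RatFunc C)) : Prop :=
  IsVSBasis C r W ∧ (∀ i, IntegralAt C ℓ r α (W i)) ∧
    ∀ f : Fin r → RatFunc C, IntegralAt C ℓ r α f → f ∈ localSpan C r α W

/-- The standard basis `1, S, …, S^{r-1}` of `A`. -/
def stdBasis : Fin r → (Fin r → RatFunc C) :=
  fun i j => if j = i then 1 else 0

/-- The shift automorphism `p(x) ↦ p(x+c)` of the polynomial ring. -/
def polyShiftEquiv (c : C) : Polynomial C ≃+* Polynomial C where
  toFun p := p.comp (X + Polynomial.C c)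
  invFun p := p.comp (X - Polynomial.C c)
  left_inv p := by
    show (p.comp (X + Polynomial.C c)).comp (X - Polynomial.C c) = p
    rw [Polynomial.comp_assoc]; simp
  right_inv p := by
    show (p.comp (X - Polynomial.C c)).comp (X + Polynomial.C c) = p
    rw [Polynomial.comp_assoc]; simp
  map_add' p q := by simp [Polynomial.add_comp]
  map_mul' p q := by simp [Polynomial.mul_comp]

/-- The shift `σ^k`, `p(x) ↦ p(x+k)`, on polynomials, for `k : ℤ`. -/
def polyShift (k : ℤ) (p : Polynomial C) : Polynomial C := polyShiftEquiv C (k : C) p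

/-- `σ` on polynomials. -/
def polyσ : Polynomial C ≃+* Polynomial C := polyShiftEquiv C 1

/-- The shift automorphism `σ : f(x) ↦ f(x+1)` of the rational function field. -/
def ratσ : RatFunc C →+* RatFunc C :=
  RatFunc.mapRingHom (polyσ C : Polynomial C →+* Polynomial C)
    (by
      intro p hp
      simp only [Submonoid.mem_comap]
      refine mem_nonZeroDivisors_iff_ne_zero.mpr ?_
      have hp0 : p ≠ 0 := mem_nonZeroDivisors_iff_ne_zero.mp hp
      simpa using (map_ne_zero_iff _ (polyσ C).injective).mpr hp0)

variable [NeZero r]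

/-- The index `r - 1` as an element of `Fin r`. -/
def lastIdx : Fin r := ⟨r - 1, Nat.sub_lt (Nat.pos_of_ne_zero (NeZero.ne r)) one_pos⟩

/-- The action of `S` on `A = C(x)[S]/⟨L⟩`, on coefficient vectors with respect to the
basis `1, S, …, S^{r-1}`, using `S^r = -(ℓ₀/ℓ_r) - ⋯ - (ℓ_{r-1}/ℓ_r) S^{r-1}`. -/
def Smap (f : Fin r → RatFunc C) : Fin r → RatFunc C :=
  fun j =>
    (if (j : ℕ) = 0 then 0 else
      ratσ C (f ⟨(j : ℕ) - 1, lt_of_le_of_lt (Nat.sub_le _ _) j.isLt⟩))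
      - ratσ C (f (lastIdx r)) * (toRat C (ℓ j) / toRat C (ℓ r))

/-- The difference operator `Δ = S - 1` on `A`. -/
def Dmap (f : Fin r → RatFunc C) : Fin r → RatFunc C :=
  Smap C ℓ r f - f

/-- `f ∈ A` is summable. -/
def IsSummable (f : Fin r → RatFunc C) : Prop :=
  ∃ g : Fin r → RatFunc C, f = Dmap C ℓ r g

/-- `disp_α(p) ≥ k`: `p` has two roots in `α + ℤ` at distance `k`. -/
def DispGe (α : Cbar C) (p : Polynomial (Cbar C)) (k : ℕ) : Prop :=
  ∃ m : ℤ, Polynomial.eval (α + (m : Cbar C)) p = 0 ∧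
    Polynomial.eval (α + (m : Cbar C) + (k : Cbar C)) p = 0

/-- The dispersion `disp_α(p)` as an extended natural number
(`0` by convention for the empty set, which is excluded by the hypotheses below). -/
def dispVal (α : Cbar C) (p : Polynomial (Cbar C)) : ℕ∞ :=
  sSup ((fun k : ℕ => (k : ℕ∞)) '' {k : ℕ | DispGe C α p k})

/-- A polynomial is shift-free if it is coprime to each of its nontrivial shifts. -/
def ShiftFree {K : Type*} [Field K] [CharZero K] (p : Polynomial K) : Prop :=
  ∀ k : ℤ, k ≠ 0 → IsCoprime p (p.comp (X + Polynomial.C (k : K)))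


/-- The data of the orbits `α_i + ℤ` of the roots of `ℓ₀ℓ_r`, with the minimal root
`minR i = α_{i,1}`, the maximal root `maxR i = α_{i,J_i}`, and the chosen bounds `β i`. -/
structure SuitableData (I : ℕ) where
  β : Fin I → Cbar C
  minR : Fin I → Cbar C
  maxR : Fin I → Cbar C
  minR_root : ∀ i, (Polynomial.aeval (minR i)) (ℓ 0 * ℓ r) = 0
  maxR_root : ∀ i, (Polynomial.aeval (maxR i)) (ℓ 0 * ℓ r) = 0
  minR_le_maxR : ∀ i, ∃ m : ℕ, maxR i = minR i + (m : Cbar C)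
  maxR_le_β : ∀ i, ∃ m : ℕ, β i = maxR i + (m : Cbar C)
  roots_between : ∀ i (m : ℤ), (Polynomial.aeval (minR i + (m : Cbar C))) (ℓ 0 * ℓ r) = 0 →
    0 ≤ m ∧ ∃ k : ℕ, maxR i = minR i + (m : Cbar C) + (k : Cbar C)
  orbits_distinct : ∀ i i', i ≠ i' → ∀ m : ℤ, β i ≠ β i' + (m : Cbar C)
  orbits_cover : ∀ ξ : Cbar C, (Polynomial.aeval ξ) (ℓ 0 * ℓ r) = 0 →
    ∃ i, ∃ m : ℤ, ξ = β i + (m : Cbar C)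
  conj_compat : ∀ (φ : Cbar C ≃ₐ[C] Cbar C) (i i' : Fin I), φ (maxR i) = maxR i' →
    β i - maxR i = β i' - maxR i'

/-- Membership in `Z = ⋃ᵢ {γ ∈ αᵢ + ℤ : α_{i,1} < γ ≤ βᵢ}`. -/
def memZ {I : ℕ} (D : SuitableData C ℓ r I) (γ : Cbar C) : Prop :=
  ∃ i, (∃ m : ℕ, γ + (m : Cbar C) = D.β i) ∧ (∃ k : ℕ, 1 ≤ k ∧ γ = D.minR i + (k : Cbar C))

/-- `W` is a suitable basis of `A` at `{β₁, …, β_I}`. -/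
def IsSuitableBasis {I : ℕ} (D : SuitableData C ℓ r I) (W : Fin r → (Fin r → RatFunc C)) :
    Prop :=
  IsVSBasis C r W ∧
    (∀ γ : Cbar C, memZ C ℓ r D γ → IsLocalIntegralBasis C ℓ r γ W) ∧
    (∀ γ : Cbar C, ¬ memZ C ℓ r D γ → localSpan C r γ W = localSpan C r γ (stdBasis C r))

section Helpers

set_option linter.unusedSectionVars false

variable {C} {ℓ} {r}

/-- The power series in `q` obtained by evaluating a polynomial at `a + q`. -/
def expandAt (a : Cbar C) : Polynomial C →+* PowerSeries (Cbar C) :=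
  Polynomial.coeToPowerSeries.ringHom.comp
    ((Polynomial.compRingHom (X + Polynomial.C a)).comp
      (Polynomial.mapRingHom (algebraMap C (Cbar C))))

lemma expandAt_injective (a : Cbar C) : Function.Injective (expandAt a) := by
  rw [injective_iff_map_eq_zero]
  intro p hp
  have h : (p.map (algebraMap C (Cbar C))).comp (X + Polynomial.C a) = 0 := by
    simpa [expandAt] using hp
  have h2 := congrArg (fun s => s.comp (X - Polynomial.C a)) h
  simp only [Polynomial.comp_assoc] at h2
  simpa [Polynomial.map_eq_zero_iff (algebraMap C (Cbar C)).injective] using h2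

lemma constantCoeff_expandAt (a : Cbar C) (p : Polynomial C) :
    PowerSeries.constantCoeff (expandAt a p) = Polynomial.aeval a p := by
  simp [expandAt, Polynomial.coeff_zero_eq_eval_zero, Polynomial.eval_comp,
    Polynomial.eval_map_algebraMap]

lemma eval₂_point_eq (α : Cbar C) (m : ℤ) (p : Polynomial C) :
    Polynomial.eval₂ ((algebraMap (Cbar C) (LS C)).comp (algebraMap C (Cbar C)))
      (algebraMap (Cbar C) (LS C) α + (m : LS C) + qv C) p =
    HahnSeries.ofPowerSeries ℤ (Cbar C) (expandAt (α + (m : Cbar C)) p) := by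
  have hC : ∀ a : Cbar C, HahnSeries.ofPowerSeries ℤ (Cbar C) (PowerSeries.C a) =
      algebraMap (Cbar C) (LS C) a := by
    intro a
    rfl
  have h : Polynomial.eval₂RingHom ((algebraMap (Cbar C) (LS C)).comp (algebraMap C (Cbar C)))
      (algebraMap (Cbar C) (LS C) α + (m : LS C) + qv C) =
      (HahnSeries.ofPowerSeries ℤ (Cbar C)).comp (expandAt (α + (m : Cbar C))) := by
    apply Polynomial.ringHom_ext
    · intro a
      simp [expandAt, hC]
    · have hm : HahnSeries.ofPowerSeries ℤ (Cbar C) (PowerSeries.C (m : Cbar C)) = (m : LS C) := by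
        simp
      simp only [Polynomial.coe_eval₂RingHom, Polynomial.eval₂_X, expandAt, RingHom.comp_apply,
        Polynomial.coe_mapRingHom, Polynomial.map_X, Polynomial.coe_compRingHom_apply,
        Polynomial.X_comp, Polynomial.coeToPowerSeries.ringHom_apply, 
        Polynomial.coe_X, Polynomial.coe_C, map_add, HahnSeries.ofPowerSeries_X, hC α, hm, qv]
      ring
  exact congrArg (fun φ => φ p) h

lemma eval₂_point_ne_zero (α : Cbar C) (m : ℤ) {p : Polynomial C} (hp : p ≠ 0) :
    Polynomial.eval₂ ((algebraMap (Cbar C) (LS C)).comp (algebraMap C (Cbar C)))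
      (algebraMap (Cbar C) (LS C) α + (m : LS C) + qv C) p ≠ 0 := by
  rw [eval₂_point_eq]
  simpa [map_eq_zero_iff _ HahnSeries.ofPowerSeries_injective,
    map_eq_zero_iff _ (expandAt_injective (α + (m : Cbar C)))] using hp

lemma evalAt_add (α : Cbar C) (m : ℤ) (f g : RatFunc C) :
    evalAt C α m (f + g) = evalAt C α m f + evalAt C α m g :=
  RatFunc.eval_add _ _ (eval₂_point_ne_zero α m (RatFunc.denom_ne_zero f))
    (eval₂_point_ne_zero α m (RatFunc.denom_ne_zero g))

lemma evalAt_mul (α : Cbar C) (m : ℤ) (f g : RatFunc C) :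
    evalAt C α m (f * g) = evalAt C α m f * evalAt C α m g :=
  RatFunc.eval_mul _ _ (eval₂_point_ne_zero α m (RatFunc.denom_ne_zero f))
    (eval₂_point_ne_zero α m (RatFunc.denom_ne_zero g))

/-- Evaluation at `α + m + q` as a ring homomorphism. -/
def evalAtHom (α : Cbar C) (m : ℤ) : RatFunc C →+* LS C where
  toFun := evalAt C α m
  map_zero' := RatFunc.eval_zero _ _
  map_one' := RatFunc.eval_one _ _
  map_add' := evalAt_add α m
  map_mul' := evalAt_mul α m

lemma evalAtHom_apply (α : Cbar C) (m : ℤ) (f : RatFunc C) :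
    evalAtHom α m f = evalAt C α m f := rfl

lemma evalAtHom_toRat (α : Cbar C) (m : ℤ) (p : Polynomial C) :
    evalAtHom α m (toRat C p) =
      HahnSeries.ofPowerSeries ℤ (Cbar C) (expandAt (α + (m : Cbar C)) p) := by
  rw [← eval₂_point_eq]
  exact RatFunc.eval_algebraMap _ _ _

lemma evalAt_add_one (α : Cbar C) (m : ℤ) (f : RatFunc C) :
    evalAt C (α + 1) m f = evalAt C α (m + 1) f := by
  unfold evalAt
  congr 1
  rw [Int.cast_add, Int.cast_one, map_add (algebraMap (Cbar C) (LS C)),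
    map_one (algebraMap (Cbar C) (LS C))]
  ring

lemma expandAt_polyσ (a : Cbar C) (p : Polynomial C) :
    expandAt a (polyσ C p) = expandAt (a + 1) p := by
  have h : (polyσ C p) = p.comp (X + Polynomial.C 1) := rfl
  rw [h]
  simp only [expandAt, RingHom.comp_apply, Polynomial.coe_mapRingHom, Polynomial.map_comp,
    Polynomial.coe_compRingHom_apply, Polynomial.comp_assoc]
  congr 2
  simp
  ring

lemma ratσ_toRat (p : Polynomial C) : ratσ C (toRat C p) = toRat C (polyσ C p) := by
  have := RatFunc.map_apply_div (polyσ C : Polynomial C →+* Polynomial C)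
    (by
      intro p hp
      simp only [Submonoid.mem_comap]
      refine mem_nonZeroDivisors_iff_ne_zero.mpr ?_
      have hp0 : p ≠ 0 := mem_nonZeroDivisors_iff_ne_zero.mp hp
      simpa using (map_ne_zero_iff _ (polyσ C).injective).mpr hp0) p 1
  simp only [map_one, div_one] at this
  exact this

lemma ratFunc_eq_div (f : RatFunc C) : ∃ p q : Polynomial C, q ≠ 0 ∧ IsCoprime p q ∧
    f = toRat C p / toRat C q :=
  ⟨f.num, f.denom, RatFunc.denom_ne_zero f, RatFunc.isCoprime_num_denom f,
    (RatFunc.num_div_denom f).symm⟩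

lemma evalAt_ratσ (α : Cbar C) (m : ℤ) (f : RatFunc C) :
    evalAt C α m (ratσ C f) = evalAt C α (m + 1) f := by
  obtain ⟨p, q, -, -, rfl⟩ := ratFunc_eq_div f
  simp only [← evalAtHom_apply, map_div₀, ratσ_toRat, evalAtHom_toRat, expandAt_polyσ]
  push_cast
  simp only [add_assoc]

/-! ### The valuation -/

lemma nuq_zero : nuq C 0 = ⊤ := by simp [nuq]

lemma nuq_ne_bot (a : LS C) : nuq C a ≠ ⊥ := by
  unfold nuq
  split_ifs <;> simp

lemma nuq_mul (a b : LS C) : nuq C (a * b) = nuq C a + nuq C b := by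
  by_cases ha : a = 0
  · subst ha
    rw [zero_mul, nuq_zero, EReal.top_add_of_ne_bot (nuq_ne_bot b)]
  by_cases hb : b = 0
  · subst hb
    rw [mul_zero, nuq_zero, EReal.add_top_of_ne_bot (nuq_ne_bot a)]
  simp only [nuq, ha, hb, mul_eq_zero, or_self, if_false]
  rw [HahnSeries.order_mul ha hb]
  push_cast
  rfl

lemma min_nuq_le_nuq_add (a b : LS C) : min (nuq C a) (nuq C b) ≤ nuq C (a + b) := by
  by_cases ha : a = 0
  · simp [ha]
  by_cases hb : b = 0
  · simp [hb]
  by_cases hab : a + b = 0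
  · simp [hab, nuq_zero]
  simp only [nuq, ha, hb, hab, if_false]
  have := HahnSeries.min_order_le_order_add hab
  rcases min_le_iff.mp this with h | h
  · exact min_le_of_left_le (by exact_mod_cast h)
  · exact min_le_of_right_le (by exact_mod_cast h)

lemma nuq_le_nuq_mul {s : LS C} (hs : 0 ≤ nuq C s) (a : LS C) : nuq C a ≤ nuq C (s * a) := by
  rw [nuq_mul]
  exact le_add_of_nonneg_left hs

lemma nuq_one : nuq C 1 = 0 := by simp [nuq]

lemma nuq_ofPowerSeries_nonneg (s : PowerSeries (Cbar C)) :
    0 ≤ nuq C (HahnSeries.ofPowerSeries ℤ (Cbar C) s) := by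
  by_cases hs : HahnSeries.ofPowerSeries ℤ (Cbar C) s = 0
  · simp [hs, nuq_zero]
  simp only [nuq, hs, if_false]
  have : (0 : ℤ) ≤ (HahnSeries.ofPowerSeries ℤ (Cbar C) s).order := by
    rw [HahnSeries.le_order_iff_forall hs]
    intro j hj
    rw [PowerSeries.coeff_coe, if_pos hj]
  exact_mod_cast this

lemma constantCoeff_eq_zero_of_nuq_pos {s : PowerSeries (Cbar C)}
    (h : 0 < nuq C (HahnSeries.ofPowerSeries ℤ (Cbar C) s)) :
    PowerSeries.constantCoeff s = 0 := by
  by_contra hne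
  have hc : (HahnSeries.ofPowerSeries ℤ (Cbar C) s).coeff 0 ≠ 0 := by
    rw [PowerSeries.coeff_coe]
    simpa using hne
  have hs : HahnSeries.ofPowerSeries ℤ (Cbar C) s ≠ 0 := by
    rintro h0
    simp [h0] at hc
  have h1 := HahnSeries.order_le_of_coeff_ne_zero hc
  simp only [nuq, hs, if_false] at h
  have h2 : 0 < (HahnSeries.ofPowerSeries ℤ (Cbar C) s).order := by exact_mod_cast h
  omega

lemma nuq_ofPowerSeries_pos {s : PowerSeries (Cbar C)} (h : PowerSeries.constantCoeff s = 0) :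
    0 < nuq C (HahnSeries.ofPowerSeries ℤ (Cbar C) s) := by
  by_cases hs : HahnSeries.ofPowerSeries ℤ (Cbar C) s = 0
  · simp [hs, nuq_zero]
  simp only [nuq, hs, if_false]
  have : (1 : ℤ) ≤ (HahnSeries.ofPowerSeries ℤ (Cbar C) s).order := by
    rw [HahnSeries.le_order_iff_forall hs]
    intro j hj
    rw [PowerSeries.coeff_coe]
    split_ifs with h0
    · rfl
    · have : j = 0 := by omega
      simpa [this] using h
  exact_mod_cast this

lemma nuq_evalAt_inv_toRat_nonneg {α : Cbar C} {m : ℤ} {q : Polynomial C}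
    (hq : Polynomial.aeval (α + (m : Cbar C)) q ≠ 0) : 0 ≤ nuq C (evalAt C α m (toRat C q)⁻¹) := by
  have hq0 : toRat C q ≠ 0 := by
    intro h
    have : q = 0 := by simpa using h
    simp [this] at hq
  have h1 : evalAtHom α m (toRat C q)⁻¹ * evalAtHom α m (toRat C q) = 1 := by
    rw [← map_mul, inv_mul_cancel₀ hq0, map_one]
  have h2 : nuq C (evalAtHom α m (toRat C q)) = 0 := by
    refine le_antisymm (not_lt.mp fun h => hq ?_) ?_
    · rw [evalAtHom_toRat] at h
      rw [← constantCoeff_expandAt]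
      exact constantCoeff_eq_zero_of_nuq_pos h
    · rw [evalAtHom_toRat]
      exact nuq_ofPowerSeries_nonneg _
  have h3 := congrArg (nuq C) h1
  rw [nuq_mul, h2, add_zero, nuq_one] at h3
  exact h3.ge

lemma nuq_evalAt_toRat_nonneg (α : Cbar C) (m : ℤ) (p : Polynomial C) :
    0 ≤ nuq C (evalAt C α m (toRat C p)) := by
  rw [← evalAtHom_apply, evalAtHom_toRat]
  exact nuq_ofPowerSeries_nonneg _

/-- A rational function has no pole at `α` exactly when its expansion there is integral. -/
lemma inLocalRing_iff_nuq_nonneg (α : Cbar C) (f : RatFunc C) :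
    InLocalRing C α f ↔ 0 ≤ nuq C (evalAt C α 0 f) := by
  constructor
  · rintro ⟨p, q, hq, rfl⟩
    rw [div_eq_mul_inv, evalAt_mul]
    refine (nuq_evalAt_inv_toRat_nonneg (m := 0) (by simpa using hq)).trans
      (nuq_le_nuq_mul (nuq_evalAt_toRat_nonneg α 0 p) _)
  · intro h
    obtain ⟨p, q, hq0, hpq, rfl⟩ := ratFunc_eq_div f
    refine ⟨p, q, fun hq => ?_, rfl⟩
    have hp : 0 < nuq C (evalAtHom α 0 (toRat C p)) := by
      have hq0' : toRat C q ≠ 0 := by simpa using hq0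
      rw [show toRat C p = toRat C p / toRat C q * toRat C q by field_simp, map_mul]
      refine lt_of_lt_of_le ?_ (nuq_le_nuq_mul h _)
      rw [evalAtHom_toRat]
      exact nuq_ofPowerSeries_pos (by rw [constantCoeff_expandAt]; simpa using hq)
    rw [evalAtHom_toRat] at hp
    have hp0 := constantCoeff_eq_zero_of_nuq_pos hp
    rw [constantCoeff_expandAt] at hp0
    obtain ⟨a, b, hab⟩ := hpq
    have := congrArg (Polynomial.aeval α) hab
    simp only [Int.cast_zero, add_zero] at hp0
    simp [hp0, hq] at this

/-! ### Integrality and solutions -/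

lemma integralAt_iff (α : Cbar C) (f : Fin r → RatFunc C) :
    IntegralAt C ℓ r α f ↔ ∀ b ∈ SolSet C ℓ r α,
      liminf (fun n : ℕ => nuq C (b (-(n : ℤ)))) atTop = ⊤ ∨
      liminf (fun n : ℕ => nuq C (b (-(n : ℤ)))) atTop ≤ nuq C (elemApply C r α f b 0) := by
  unfold IntegralAt valAt
  rw [le_iInf₂_iff]
  refine forall₂_congr fun b _ => ?_
  unfold esub
  split_ifs with h
  · simp [h]
  · rw [EReal.sub_nonneg (Or.inr h) (Or.inl (nuq_ne_bot _))]
    simp [h]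

/-- Shifting the argument identifies the solutions at `α` with those at `α + 1`. -/
lemma shift_mem_solSet_iff (α : Cbar C) (b : ℤ → LS C) :
    (fun n => b (n + 1)) ∈ SolSet C ℓ r (α + 1) ↔ b ∈ SolSet C ℓ r α := by
  simp only [SolSet, Set.mem_ofPred_eq, evalAt_add_one]
  constructor
  · intro h n
    have := h (n - 1)
    rw [← this]
    refine Finset.sum_congr rfl fun i _ => ?_
    rw [sub_add_cancel, show n - 1 + (i : ℤ) + 1 = n + i by ring]
  · intro h n
    have := h (n + 1)
    rw [← this]
    refine Finset.sum_congr rfl fun i _ => ?_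
    rw [show n + 1 + (i : ℤ) = n + i + 1 by ring]

lemma elemApply_Smap (hℓ : ℓ r ≠ 0) {α : Cbar C} {b : ℤ → LS C}
    (hb : b ∈ SolSet C ℓ r α) (f : Fin r → RatFunc C) (n : ℤ) :
    elemApply C r α (Smap C ℓ r f) b n =
      elemApply C r (α + 1) f (fun n => b (n + 1)) n := by
  obtain ⟨s, rfl⟩ : ∃ s, r = s + 1 := Nat.exists_eq_succ_of_ne_zero (NeZero.ne r)
  have hr0 : toRat C (ℓ (s + 1)) ≠ 0 := by simpa using hℓ
  have hE : evalAtHom α n (toRat C (ℓ (s + 1))) ≠ 0 := by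
    simpa using hr0
  have hsol : ∑ j : Fin (s + 1), evalAtHom α n (toRat C (ℓ j)) * b (n + (j : ℕ)) =
      - (evalAtHom α n (toRat C (ℓ (s + 1))) * b (n + (s + 1 : ℕ))) := by
    have h := hb n
    rw [Finset.sum_range_succ, Finset.sum_range] at h
    exact eq_neg_of_add_eq_zero_left h
  have hlast : lastIdx (s + 1) = Fin.last s := rfl
  have h1 : elemApply C (s + 1) α (Smap C ℓ (s + 1) f) b n =
      ∑ j : Fin s, evalAt C α (n + 1) (f j.castSucc) * b (n + 1 + (j : ℕ)) -
      evalAt C α (n + 1) (f (Fin.last s)) / evalAtHom α n (toRat C (ℓ (s + 1))) *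
        ∑ j : Fin (s + 1), evalAtHom α n (toRat C (ℓ j)) * b (n + (j : ℕ)) := by
    have h0 : ∀ j : Fin (s + 1), evalAt C α n (Smap C ℓ (s + 1) f j) * b (n + (j : ℕ)) =
        evalAtHom α n (if (j : ℕ) = 0 then 0 else
          ratσ C (f ⟨(j : ℕ) - 1, lt_of_le_of_lt (Nat.sub_le _ _) j.isLt⟩)) * b (n + (j : ℕ)) -
        evalAt C α (n + 1) (f (Fin.last s)) / evalAtHom α n (toRat C (ℓ (s + 1))) *
          (evalAtHom α n (toRat C (ℓ j)) * b (n + (j : ℕ))) := by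
      intro j
      rw [← evalAtHom_apply, Smap, map_sub, map_mul, map_div₀, hlast, evalAtHom_apply α n (ratσ C _),
        evalAt_ratσ]
      ring
    unfold elemApply
    rw [Finset.sum_congr rfl fun j _ => h0 j, Finset.sum_sub_distrib, ← Finset.mul_sum]
    congr 1
    rw [Fin.sum_univ_succ]
    simp only [Fin.val_zero, if_true, map_zero, zero_mul, zero_add]
    refine Finset.sum_congr rfl fun j _ => ?_
    simp only [Fin.val_succ, Nat.succ_ne_zero, if_false, Nat.add_sub_cancel, evalAtHom_apply,
      evalAt_ratσ]
    push_cast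
    rw [show n + ((j : ℕ) + 1 : ℤ) = n + 1 + (j : ℕ) by ring]
    rfl
  rw [h1, hsol]
  unfold elemApply
  rw [Fin.sum_univ_castSucc]
  simp only [evalAt_add_one, Fin.val_castSucc, Fin.val_last]
  rw [mul_neg, sub_neg_eq_add, ← mul_assoc, div_mul_cancel₀ _ hE]
  push_cast
  congr 1
  · refine Finset.sum_congr rfl fun j _ => ?_
    rw [show n + 1 + ((j : ℕ) : ℤ) = n + (j : ℕ) + 1 by ring]
  · rw [show n + ((s : ℤ) + 1) = n + s + 1 by ring]

lemma integralAt_Smap_iff (hℓ : ℓ r ≠ 0) (α : Cbar C) (f : Fin r → RatFunc C) :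
    IntegralAt C ℓ r α (Smap C ℓ r f) ↔ IntegralAt C ℓ r (α + 1) f := by
  have hlim : ∀ b : ℤ → LS C, liminf (fun n : ℕ => nuq C (b (-(n : ℤ) + 1))) atTop =
      liminf (fun n : ℕ => nuq C (b (-(n : ℤ)))) atTop := by
    intro b
    rw [← liminf_nat_add (fun n : ℕ => nuq C (b (-(n : ℤ) + 1))) 1]
    simp
  rw [integralAt_iff, integralAt_iff]
  constructor
  · intro h b hb
    have hb' : (fun n => b (n - 1)) ∈ SolSet C ℓ r α := by
      rw [← shift_mem_solSet_iff]
      simpa using hb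
    have := h _ hb'
    have hl := hlim fun n => b (n - 1)
    rw [elemApply_Smap hℓ hb', ← hl] at this
    simpa using this
  · intro h b hb
    have := h _ ((shift_mem_solSet_iff α b).mpr hb)
    rw [elemApply_Smap hℓ hb]
    simpa only [hlim b] using this

/-- A one-sided linear recurrence with nonvanishing leading coefficient has a solution for any
initial values. -/
lemma exists_recurrence {K : Type*} [Field K] (s : ℕ) (B : ℕ → ℕ → K)
    (hB : ∀ n, B s n ≠ 0) (w : ℕ → K) :
    ∃ f : ℕ → K, (∀ i < s, f i = w i) ∧
      ∀ n, ∑ i ∈ Finset.range (s + 1), B i n * f (n + i) = 0 := by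
  let step : (n : ℕ) → ((m : ℕ) → m < n → K) → K := fun n g =>
    if h : n < s then w n else
      -(B s (n - s))⁻¹ * ∑ i : Fin s, B i (n - s) * g (n - s + i) (by omega)
  let f : ℕ → K := WellFoundedLT.fix step
  have hf : ∀ n, f n = step n fun m _ => f m := fun n => WellFoundedLT.fix_eq step n
  refine ⟨f, fun i hi => ?_, fun n => ?_⟩
  · rw [hf]
    simp [step, hi]
  · rw [Finset.sum_range_succ, hf (n + s), Finset.sum_range]
    simp only [step, Nat.not_lt.mpr (Nat.le_add_left s n), dite_false, Nat.add_sub_cancel]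
    have := hB n
    field_simp
    ring

/-- Solutions with prescribed values on a window of length `r`. -/
lemma exists_solution (hℓ : ℓ 0 * ℓ r ≠ 0) (α : Cbar C) (w : ℕ → LS C) :
    ∃ b ∈ SolSet C ℓ r α, ∀ i : ℕ, i < r → b i = w i := by
  have hne : ∀ p : Polynomial C, p ≠ 0 → ∀ n : ℤ, evalAt C α n (toRat C p) ≠ 0 := by
    intro p hp n
    rw [← evalAtHom_apply]
    simpa using hp
  obtain ⟨f, hf0, hf⟩ := exists_recurrence r (fun i n => evalAt C α (n : ℤ) (toRat C (ℓ i)))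
    (fun n => hne _ (right_ne_zero_of_mul hℓ) _) w
  obtain ⟨g, hg0, hg⟩ := exists_recurrence r
    (fun i n => evalAt C α (-(n : ℤ) - 1) (toRat C (ℓ (r - i))))
    (fun n => by simpa using hne _ (left_ne_zero_of_mul hℓ) _) (fun i => w (r - 1 - i))
  let b : ℤ → LS C := fun k => if 0 ≤ k then f k.toNat else g ((r : ℤ) - 1 - k).toNat
  have hbf : ∀ k : ℕ, b k = f k := fun k => by simp [b]
  have hbg : ∀ k : ℕ, b ((r : ℤ) - 1 - k) = g k := by
    intro k
    simp only [b]
    split_ifs with h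
    · rw [hf0 _ (by omega), hg0 k (by omega)]
      congr 1
      omega
    · congr 1
      omega
  refine ⟨b, fun n => ?_, fun i hi => by rw [hbf, hf0 i hi]⟩
  rcases lt_or_ge n 0 with hn | hn
  · obtain ⟨m, rfl⟩ : ∃ m : ℕ, n = -(m : ℤ) - 1 := ⟨(-n - 1).toNat, by omega⟩
    rw [← hg m, ← Finset.sum_range_reflect]
    refine Finset.sum_congr rfl fun i hi => ?_
    have hi' : i ≤ r := by simpa [Nat.lt_succ_iff] using hi
    rw [← hbg]
    have : r + 1 - 1 - i = r - i := by omega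
    rw [this]
    congr 2
    omega
  · obtain ⟨m, rfl⟩ := Int.eq_ofNat_of_zero_le hn
    rw [← hf m]
    refine Finset.sum_congr rfl fun i _ => ?_
    rw [← hbf]
    push_cast
    rfl

section Window

variable {N : AddSubmonoid (LS C)} (hN : ∀ s : LS C, 0 ≤ nuq C s → ∀ x ∈ N, s * x ∈ N)
include hN

/-- The recurrence determines `b (n + k)` integrally from the other terms whenever `ℓ k` does not
vanish at `α + n`. -/
lemma mem_of_recurrence {α : Cbar C} {b : ℤ → LS C} (hb : b ∈ SolSet C ℓ r α) {n : ℤ} {k : ℕ}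
    (hk : k ≤ r) (hℓ : Polynomial.aeval (α + (n : Cbar C)) (ℓ k) ≠ 0)
    (h : ∀ i : ℕ, i ≤ r → i ≠ k → b (n + i) ∈ N) : b (n + k) ∈ N := by
  have hk0 : toRat C (-ℓ k) ≠ 0 := by
    intro h0
    have : ℓ k = 0 := by simpa using h0
    simp [this] at hℓ
  have hrec := hb n
  rw [← Finset.add_sum_erase _ _ (Finset.mem_range.mpr (Nat.lt_succ_of_le hk))] at hrec
  have hmem : ∑ i ∈ (Finset.range (r + 1)).erase k,
      evalAt C α n (toRat C (ℓ i)) * b (n + i) ∈ N := by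
    refine sum_mem fun i hi => hN _ (nuq_evalAt_toRat_nonneg α n (ℓ i)) _ ?_
    rw [Finset.mem_erase, Finset.mem_range, Nat.lt_succ_iff] at hi
    exact h i hi.2 hi.1
  have h1 : evalAtHom α n (toRat C (-ℓ k)) ≠ 0 := by simpa using hk0
  have h2 : b (n + k) = evalAt C α n (toRat C (-ℓ k))⁻¹ *
      ∑ i ∈ (Finset.range (r + 1)).erase k, evalAt C α n (toRat C (ℓ i)) * b (n + i) := by
    rw [eq_neg_of_add_eq_zero_right hrec, ← evalAtHom_apply, map_inv₀, eq_inv_mul_iff_mul_eq₀ h1,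
      map_neg, map_neg, evalAtHom_apply]
    ring
  rw [h2]
  exact hN _ (nuq_evalAt_inv_toRat_nonneg (by simpa using hℓ)) _ hmem

variable {α : Cbar C} (hr : 1 ≤ r)
  (hroot : ∀ n : ℕ, 1 ≤ n → Polynomial.aeval (α - (n : Cbar C)) (ℓ 0 * ℓ r) ≠ 0)
  {b : ℤ → LS C} (hb : b ∈ SolSet C ℓ r α)
include hroot hb

include hr in
lemma window_backward (h : ∀ j : ℕ, j < r → b j ∈ N) (n : ℕ) :
    ∀ j : ℕ, j < r → b (-(n : ℤ) + j) ∈ N := by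
  induction n with
  | zero => simpa using h
  | succ n ih =>
    intro j hj
    rcases Nat.eq_zero_or_pos j with rfl | hj0
    · refine mem_of_recurrence hN hb (Nat.zero_le r) ?_ fun i hi hi0 => ?_
      · have := hroot (n + 1) (by omega)
        rw [map_mul] at this
        convert left_ne_zero_of_mul this using 2
        push_cast
        ring_nf
      · have := ih (i - 1) (by omega)
        convert this using 2
        omega
    · have := ih (j - 1) (by omega)
      convert this using 2
      omega

lemma window_forward (n : ℕ) (h : ∀ j : ℕ, j < r → b (-(n : ℤ) + j) ∈ N) :
    ∀ j : ℕ, j < r → b j ∈ N := by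
  induction n with
  | zero => simpa using h
  | succ n ih =>
    refine ih fun j hj => ?_
    rcases Nat.lt_or_ge (j + 1) r with hj' | hj'
    · have := h (j + 1) hj'
      convert this using 2
      push_cast
      ring
    · have hjr : j + 1 = r := by omega
      have : b (-((n + 1 : ℕ) : ℤ) + r) ∈ N := by
        refine mem_of_recurrence hN hb le_rfl ?_ fun i hi hi0 => h i (by omega)
        have := hroot (n + 1) (by omega)
        rw [map_mul] at this
        convert right_ne_zero_of_mul this using 2
        push_cast
        ring_nf
      convert this using 2
      rw [← hjr]
      push_cast
      ring

/-- If the values far to the left eventually lie in `N`, then so do the values at `0, …, r-1`. -/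
lemma mem_of_eventually (h : ∀ᶠ n : ℕ in atTop, b (-(n : ℤ)) ∈ N) :
    ∀ j : ℕ, j < r → b j ∈ N := by
  obtain ⟨n₀, hn₀⟩ := eventually_atTop.mp h
  refine window_forward hN hroot hb (n₀ + r) fun j hj => ?_
  have := hn₀ (n₀ + r - j) (by omega)
  convert this using 2
  omega

end Window

/-- The elements of value at least `t`. -/
def valGE (t : EReal) : AddSubmonoid (LS C) where
  carrier := {x | t ≤ nuq C x}
  zero_mem' := by simp [nuq_zero]
  add_mem' {a b} ha hb := (le_min ha hb).trans (min_nuq_le_nuq_add a b)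

/-- The elements of value greater than `t`. -/
def valGT (t : EReal) (ht : t < ⊤) : AddSubmonoid (LS C) where
  carrier := {x | t < nuq C x}
  zero_mem' := by simpa [nuq_zero] using ht
  add_mem' {a b} ha hb := (lt_min ha hb).trans_le (min_nuq_le_nuq_add a b)

lemma mul_mem_valGE (t : EReal) (s : LS C) (hs : 0 ≤ nuq C s) (x : LS C)
    (hx : x ∈ valGE (C := C) t) : s * x ∈ valGE (C := C) t :=
  le_trans (show t ≤ nuq C x from hx) (nuq_le_nuq_mul hs x)

lemma mul_mem_valGT (t : EReal) (ht : t < ⊤) (s : LS C) (hs : 0 ≤ nuq C s) (x : LS C)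
    (hx : x ∈ valGT (C := C) t ht) : s * x ∈ valGT (C := C) t ht :=
  lt_of_lt_of_le (show t < nuq C x from hx) (nuq_le_nuq_mul hs x)

/-- To the left of all roots of `ℓ 0 * ℓ r`, integrality means that the coordinates with respect
to `1, S, …, S^{r-1}` have no pole. -/
lemma integralAt_iff_of_no_roots (hr : 1 ≤ r) (hℓ : ℓ 0 * ℓ r ≠ 0) {α : Cbar C}
    (hroot : ∀ n : ℕ, 1 ≤ n → Polynomial.aeval (α - (n : Cbar C)) (ℓ 0 * ℓ r) ≠ 0)
    (f : Fin r → RatFunc C) :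
    IntegralAt C ℓ r α f ↔ ∀ j, InLocalRing C α (f j) := by
  rw [integralAt_iff]
  simp only [inLocalRing_iff_nuq_nonneg]
  constructor
  · intro h j
    obtain ⟨b, hb, hbw⟩ := exists_solution hℓ α (fun i => if i = (j : ℕ) then 1 else 0)
    have hbj : b (j : ℕ) = 1 := by simpa using hbw j j.isLt
    have hval : elemApply C r α f b 0 = evalAt C α 0 (f j) := by
      unfold elemApply
      rw [Finset.sum_eq_single j]
      · rw [zero_add, hbj, mul_one]
      · intro i _ hij
        rw [zero_add, hbw i i.isLt, if_neg (fun h => hij (Fin.ext h)), mul_zero]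
      · simp
    have hge : 0 ≤ liminf (fun n : ℕ => nuq C (b (-(n : ℤ)))) atTop := by
      refine le_liminf_of_le (h := Eventually.of_forall fun n => ?_)
      have := window_backward (mul_mem_valGE 0) hr hroot hb (fun i hi => ?_) n 0 (by omega)
      · change 0 ≤ nuq C _ at this
        simpa using this
      · rw [hbw i hi]
        change 0 ≤ nuq C _
        split_ifs
        · exact nuq_one.ge
        · simp [nuq_zero]
    rcases h b hb with htop | hle
    · exfalso
      have hev : ∀ᶠ n : ℕ in atTop, 0 < nuq C (b (-(n : ℤ))) :=
        eventually_lt_of_lt_liminf (by rw [htop]; exact EReal.zero_lt_top)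
      have := mem_of_eventually (mul_mem_valGT 0 EReal.zero_lt_top) hroot hb hev j j.isLt
      rw [hbj] at this
      exact absurd nuq_one (ne_of_gt this)
    · rw [hval] at hle
      exact hge.trans hle
  · intro h b hb
    right
    by_contra! hlt
    have ht : nuq C (elemApply C r α f b 0) < ⊤ := hlt.trans_le le_top
    have hmem := mem_of_eventually (mul_mem_valGT _ ht) hroot hb (eventually_lt_of_lt_liminf hlt)
    have : elemApply C r α f b 0 ∈ valGT _ ht := by
      refine sum_mem fun i _ => mul_mem_valGT _ ht _ (h i) _ ?_
      rw [zero_add]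
      exact hmem i i.isLt
    exact lt_irrefl (nuq C (elemApply C r α f b 0)) this

/-! ### Local rings and local spans -/

lemma mem_localSpan_iff {α : Cbar C} {W : Fin r → (Fin r → RatFunc C)}
    (hW : LinearIndependent (RatFunc C) W) (a : Fin r → RatFunc C) :
    ∑ i, a i • W i ∈ localSpan C r α W ↔ ∀ i, InLocalRing C α (a i) := by
  constructor
  · rintro ⟨c, hc, h⟩ i
    have := hW.fintypeLinearCombination_injective
      (by simpa [Fintype.linearCombination_apply] using h)
    rw [this]
    exact hc i
  · exact fun h => ⟨a, h, rfl⟩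

lemma mem_localSpan_stdBasis_iff {α : Cbar C} (f : Fin r → RatFunc C) :
    f ∈ localSpan C r α (stdBasis C r) ↔ ∀ i, InLocalRing C α (f i) := by
  have h : ∀ c : Fin r → RatFunc C, ∑ i, c i • stdBasis C r i = c := by
    intro c
    ext j
    simp [stdBasis, Finset.sum_apply]
  constructor
  · rintro ⟨c, hc, rfl⟩
    rwa [h]
  · exact fun hf => ⟨f, hf, (h f).symm⟩

lemma inLocalRing_toRat (α : Cbar C) (p : Polynomial C) : InLocalRing C α (toRat C p) :=
  ⟨p, 1, by simp, by simp⟩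

lemma inLocalRing_inv_toRat {α : Cbar C} {q : Polynomial C} (hq : Polynomial.aeval α q ≠ 0) :
    InLocalRing C α (toRat C q)⁻¹ :=
  ⟨1, q, hq, by simp⟩

lemma InLocalRing.mul {α : Cbar C} {f g : RatFunc C} (hf : InLocalRing C α f)
    (hg : InLocalRing C α g) : InLocalRing C α (f * g) := by
  rw [inLocalRing_iff_nuq_nonneg] at *
  rw [evalAt_mul]
  exact hg.trans (nuq_le_nuq_mul hf _)

lemma InLocalRing.add {α : Cbar C} {f g : RatFunc C} (hf : InLocalRing C α f)
    (hg : InLocalRing C α g) : InLocalRing C α (f + g) := by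
  rw [inLocalRing_iff_nuq_nonneg] at *
  rw [evalAt_add]
  exact (le_min hf hg).trans (min_nuq_le_nuq_add _ _)

lemma InLocalRing.sub {α : Cbar C} {f g : RatFunc C} (hf : InLocalRing C α f)
    (hg : InLocalRing C α g) : InLocalRing C α (f - g) := by
  have : f - g = f + toRat C (-1) * g := by
    simp
    ring
  rw [this]
  exact hf.add ((inLocalRing_toRat α _).mul hg)

lemma inLocalRing_zero (α : Cbar C) : InLocalRing C α 0 := by
  simpa using inLocalRing_toRat α 0

lemma inLocalRing_ratσ_iff (α : Cbar C) (f : RatFunc C) :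
    InLocalRing C α (ratσ C f) ↔ InLocalRing C (α + 1) f := by
  rw [inLocalRing_iff_nuq_nonneg, inLocalRing_iff_nuq_nonneg, evalAt_ratσ, evalAt_add_one]

lemma inLocalRing_Smap_iff {α : Cbar C} (hroot : Polynomial.aeval α (ℓ 0 * ℓ r) ≠ 0)
    (f : Fin r → RatFunc C) :
    (∀ j, InLocalRing C α (Smap C ℓ r f j)) ↔ ∀ j, InLocalRing C (α + 1) (f j) := by
  rw [map_mul] at hroot
  have h0 := left_ne_zero_of_mul hroot
  have hr := right_ne_zero_of_mul hroot
  have hdiv : ∀ j, InLocalRing C α (toRat C (ℓ j) / toRat C (ℓ r)) := fun j =>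
    ⟨ℓ j, ℓ r, hr, rfl⟩
  constructor
  · intro h
    have hlast : InLocalRing C α (ratσ C (f (lastIdx r))) := by
      have h1 := h ⟨0, Nat.pos_of_ne_zero (NeZero.ne r)⟩
      simp only [Smap, if_true] at h1
      have h2 : ratσ C (f (lastIdx r)) = toRat C (-ℓ r) * (toRat C (ℓ 0))⁻¹ *
          (0 - ratσ C (f (lastIdx r)) * (toRat C (ℓ 0) / toRat C (ℓ r))) := by
        have h0' : toRat C (ℓ 0) ≠ 0 := by
          intro h
          have : ℓ 0 = 0 := by simpa using h
          simp [this] at h0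
        have hr' : toRat C (ℓ r) ≠ 0 := by
          intro h
          have : ℓ r = 0 := by simpa using h
          simp [this] at hr
        rw [map_neg]
        field_simp
        ring
      rw [h2]
      exact ((inLocalRing_toRat α _).mul (inLocalRing_inv_toRat h0)).mul h1
    intro j
    rw [← inLocalRing_ratσ_iff]
    rcases Nat.lt_or_ge ((j : ℕ) + 1) r with hj | hj
    · have h1 := (h ⟨j + 1, hj⟩).add (hlast.mul (hdiv (j + 1)))
      simpa [Smap] using h1
    · have : j = lastIdx r := Fin.ext (by simp only [lastIdx]; omega)
      rw [this]
      exact hlast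
  · intro h j
    refine InLocalRing.sub ?_ (((inLocalRing_ratσ_iff α _).mpr (h _)).mul (hdiv j))
    split_ifs
    · exact inLocalRing_zero α
    · exact (inLocalRing_ratσ_iff α _).mpr (h _)

lemma finite_not_inLocalRing (f : RatFunc C) : {γ : Cbar C | ¬ InLocalRing C γ f}.Finite := by
  refine (Polynomial.finite_setOfPred_isRoot (p := f.denom.map (algebraMap C (Cbar C)))
    ((Polynomial.map_ne_zero_iff (algebraMap C (Cbar C)).injective).mpr
      (RatFunc.denom_ne_zero f))).subset fun γ hγ => ?_
  by_contra hne
  refine hγ ⟨f.num, f.denom, fun h => hne ?_, (RatFunc.num_div_denom f).symm⟩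
  simpa [Polynomial.IsRoot, Polynomial.eval_map_algebraMap] using h

/-- A rational function without poles is a polynomial. -/
lemma exists_polynomial_of_inLocalRing {f : RatFunc C} (h : ∀ γ : Cbar C, InLocalRing C γ f) :
    ∃ p : Polynomial C, f = toRat C p := by
  have hu : IsUnit f.denom := by
    by_contra hnu
    obtain ⟨γ, hγ⟩ := IsAlgClosed.exists_aeval_eq_zero (Cbar C) f.denom
      (fun hd => hnu (Polynomial.isUnit_iff_degree_eq_zero.mpr hd))
    obtain ⟨p, q, hq, hf⟩ := h γ
    have hq0 : q ≠ 0 := by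
      rintro rfl
      simp at hq
    obtain ⟨s, hs⟩ := (RatFunc.denom_dvd hq0).mpr ⟨p, hf⟩
    rw [hs, map_mul, hγ, zero_mul] at hq
    exact hq rfl
  have h1 : f.denom = 1 := (RatFunc.monic_denom f).eq_one_of_isUnit hu
  refine ⟨f.num, ?_⟩
  conv_lhs => rw [← RatFunc.num_div_denom f, h1]
  simp

/-! ### The module spanned by a suitable basis -/

lemma mem_localSpan_iff_integralAt {α : Cbar C} {W : Fin r → (Fin r → RatFunc C)}
    (hW : IsLocalIntegralBasis C ℓ r α W) (f : Fin r → RatFunc C) :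
    f ∈ localSpan C r α W ↔ IntegralAt C ℓ r α f := by
  refine ⟨?_, hW.2.2 f⟩
  rintro ⟨c, hc, rfl⟩
  rw [integralAt_iff]
  intro b hb
  rw [or_iff_not_imp_left]
  intro hb'
  have hi := fun i => ((integralAt_iff α (W i)).mp (hW.2.1 i) b hb).resolve_left hb'
  have h1 : elemApply C r α (∑ i, c i • W i) b 0 =
      ∑ i, evalAt C α 0 (c i) * elemApply C r α (W i) b 0 := by
    simp only [elemApply, Finset.sum_apply, Pi.smul_apply, smul_eq_mul, ← evalAtHom_apply, map_sum,
      map_mul, Finset.sum_mul, Finset.mul_sum]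
    rw [Finset.sum_comm]
    simp only [mul_assoc]
  rw [h1]
  have : ∑ i, evalAt C α 0 (c i) * elemApply C r α (W i) b 0 ∈
      valGE (C := C) (liminf (fun n : ℕ => nuq C (b (-(n : ℤ)))) atTop) :=
    sum_mem fun i _ => mul_mem_valGE _ _ ((inLocalRing_iff_nuq_nonneg α _).mp (hc i)) _ (hi i)
  exact this

/-- Away from the points `β i`, the local modules of a suitable basis are compatible with `S`. -/
lemma Smap_mem_localSpan_iff (hr : 1 ≤ r) (hℓ : ℓ 0 * ℓ r ≠ 0) {I : ℕ}
    {D : SuitableData C ℓ r I} {W : Fin r → (Fin r → RatFunc C)}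
    (hW : IsSuitableBasis C ℓ r D W) {γ : Cbar C} (hγ : ∀ i, γ ≠ D.β i)
    (f : Fin r → RatFunc C) :
    Smap C ℓ r f ∈ localSpan C r γ W ↔ f ∈ localSpan C r (γ + 1) W := by
  have hℓr := right_ne_zero_of_mul hℓ
  by_cases h1 : memZ C ℓ r D γ
  · have h2 : memZ C ℓ r D (γ + 1) := by
      obtain ⟨i, ⟨m, hm⟩, ⟨k, hk, hk'⟩⟩ := h1
      have hm0 : m ≠ 0 := by
        rintro rfl
        exact hγ i (by simpa using hm)
      obtain ⟨m, rfl⟩ := Nat.exists_eq_succ_of_ne_zero hm0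
      refine ⟨i, ⟨m, ?_⟩, ⟨k + 1, by omega, ?_⟩⟩
      · rw [← hm]
        push_cast
        ring
      · rw [hk']
        push_cast
        ring
    rw [mem_localSpan_iff_integralAt (hW.2.1 _ h1), mem_localSpan_iff_integralAt (hW.2.1 _ h2),
      integralAt_Smap_iff hℓr]
  · by_cases h2 : memZ C ℓ r D (γ + 1)
    · obtain ⟨i, ⟨m, hm⟩, ⟨k, hk, hk'⟩⟩ := id h2
      obtain ⟨k, rfl⟩ : ∃ k', k = k' + 1 := ⟨k - 1, by omega⟩
      have hk'' : γ = D.minR i + (k : Cbar C) := by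
        push_cast at hk'
        linear_combination hk'
      have hk0 : k = 0 := by
        by_contra hk0
        refine h1 ⟨i, ⟨m + 1, ?_⟩, ⟨k, by omega, hk''⟩⟩
        rw [← hm]
        push_cast
        ring
      subst hk0
      have hroot : ∀ n : ℕ, 1 ≤ n → Polynomial.aeval (γ - (n : Cbar C)) (ℓ 0 * ℓ r) ≠ 0 := by
        intro n hn h
        have := (D.roots_between i (-(n : ℤ)) (by
          convert h using 2
          rw [hk'']
          push_cast
          ring_nf)).1
        omega
      rw [hW.2.2 _ h1, mem_localSpan_stdBasis_iff, mem_localSpan_iff_integralAt (hW.2.1 _ h2),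
        ← integralAt_iff_of_no_roots hr hℓ hroot, integralAt_Smap_iff hℓr]
    · have hroot : Polynomial.aeval γ (ℓ 0 * ℓ r) ≠ 0 := by
        intro h
        obtain ⟨i, m, hm⟩ := D.orbits_cover γ h
        obtain ⟨a, ha⟩ := D.minR_le_maxR i
        obtain ⟨b, hb⟩ := D.maxR_le_β i
        have hγm : γ = D.minR i + ((a + b + m : ℤ) : Cbar C) := by
          rw [hm, hb, ha]
          push_cast
          ring
        obtain ⟨hm0, k, hk⟩ := D.roots_between i (a + b + m) (hγm ▸ h)
        obtain ⟨n, hn⟩ := Int.eq_ofNat_of_zero_le hm0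
        rw [hn] at hγm hk
        have hβ : γ + ((k + b : ℕ) : Cbar C) = D.β i := by
          rw [hb, hk, hγm]
          push_cast
          ring
        have hn0 : n = 0 := by
          by_contra hn0
          exact h1 ⟨i, ⟨k + b, hβ⟩, ⟨n, by omega, by simpa using hγm⟩⟩
        subst hn0
        have hkb : k + b ≠ 0 := by
          intro h0
          rw [h0] at hβ
          exact hγ i (by simpa using hβ)
        obtain ⟨t, ht⟩ := Nat.exists_eq_succ_of_ne_zero hkb
        refine h2 ⟨i, ⟨t, ?_⟩, ⟨1, le_rfl, ?_⟩⟩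
        · rw [← hβ, ht]
          push_cast
          ring
        · rw [hγm]
          simp
      rw [hW.2.2 _ h1, hW.2.2 _ h2, mem_localSpan_stdBasis_iff, mem_localSpan_stdBasis_iff,
        inLocalRing_Smap_iff hroot]

lemma Smap_sum_smul (a : Fin r → RatFunc C) (W : Fin r → (Fin r → RatFunc C)) :
    Smap C ℓ r (∑ i, a i • W i) = ∑ i, ratσ C (a i) • Smap C ℓ r (W i) := by
  ext j
  simp only [Smap, Finset.sum_apply, Pi.smul_apply, smul_eq_mul, map_sum, map_mul]
  split_ifs
  · simp [Finset.sum_mul, mul_assoc]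
  · simp [Finset.sum_mul, mul_assoc, mul_sub, Finset.sum_sub_distrib]

/-- If `g - S g` only has poles at roots of `u`, and `u` times the product of the `x - β i` is
shift-free, then `g` has no poles. -/
lemma mem_localSpan_of_shiftFree (hr : 1 ≤ r) (hℓ : ℓ 0 * ℓ r ≠ 0) {I : ℕ}
    {D : SuitableData C ℓ r I} {W : Fin r → (Fin r → RatFunc C)}
    (hW : IsSuitableBasis C ℓ r D W) {u : Polynomial C}
    (hsf : ShiftFree (u.map (algebraMap C (Cbar C)) * ∏ i, (X - Polynomial.C (D.β i))))
    {a : Fin r → RatFunc C}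
    (hh : ∀ γ : Cbar C, Polynomial.aeval γ u ≠ 0 →
      Dmap C ℓ r (∑ i, a i • W i) ∈ localSpan C r γ W) (γ : Cbar C) :
    ∑ i, a i • W i ∈ localSpan C r γ W := by
  set g := ∑ i, a i • W i with hg
  set P := u.map (algebraMap C (Cbar C)) * ∏ i, (X - Polynomial.C (D.β i)) with hP
  have hsub : ∀ (γ : Cbar C) (f f' : Fin r → RatFunc C), f ∈ localSpan C r γ W →
      f' ∈ localSpan C r γ W → f - f' ∈ localSpan C r γ W := by
    rintro γ f f' ⟨c, hc, rfl⟩ ⟨c', hc', rfl⟩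
    exact ⟨c - c', fun i => (hc i).sub (hc' i), by
      simp [sub_smul, Finset.sum_sub_distrib]⟩
  -- a change of local membership between `γ + 1` and `γ` forces a root of `P` at `γ`
  have hchange : ∀ γ : Cbar C, ¬ (g ∈ localSpan C r (γ + 1) W ↔ g ∈ localSpan C r γ W) →
      P.eval γ = 0 := by
    intro γ h
    by_contra hPγ
    rw [hP, Polynomial.eval_mul, mul_eq_zero, not_or, Polynomial.eval_map_algebraMap,
      Polynomial.eval_prod, Finset.prod_eq_zero_iff] at hPγ
    have hγ : ∀ i, γ ≠ D.β i := fun i hi => hPγ.2 ⟨i, Finset.mem_univ i, by simp [hi]⟩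
    have hD := hh γ hPγ.1
    rw [← Smap_mem_localSpan_iff hr hℓ hW hγ g] at h
    refine h ⟨fun hS => ?_, fun hg' => ?_⟩
    · have := hsub γ _ _ hS hD
      simpa [Dmap] using this
    · have := hsub γ _ _ hD (hsub γ _ _ (hsub γ _ _ hg' hg') hg')
      simpa [Dmap] using this
  by_contra hbad
  let B : Set ℤ := {m | g ∉ localSpan C r (γ + (m : Cbar C)) W}
  have hBfin : B.Finite := by
    have hfin : {δ : Cbar C | g ∉ localSpan C r δ W}.Finite := by
      refine (Set.finite_iUnion fun i => finite_not_inLocalRing (a i)).subset fun δ hδ => ?_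
      have hδ' : ¬ ∀ i, InLocalRing C δ (a i) := fun h => hδ ((mem_localSpan_iff hW.1.1 a).mpr h)
      push Not at hδ'
      exact Set.mem_iUnion.mpr hδ'
    refine hfin.preimage (f := fun m : ℤ => γ + (m : Cbar C)) (Function.Injective.injOn ?_)
    intro m n h
    simpa using h
  have hB0 : B.Nonempty := ⟨0, by simpa [B] using hbad⟩
  obtain ⟨M, hM⟩ := hBfin.exists_maximal hB0
  obtain ⟨N, hN⟩ := hBfin.exists_minimal hB0
  have hNM : N ≤ M := by
    rcases le_total N M with h | h
    · exact h
    · exact hN.2 hM.1 h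
  have hMroot : P.eval (γ + (M : Cbar C)) = 0 := by
    refine hchange _ fun hiff => ?_
    have hM1 : M + 1 ∉ B := fun h => by
      have := hM.2 h (by omega)
      omega
    refine hM.1 (hiff.mp ?_)
    by_contra hnot
    refine hM1 ?_
    change g ∉ localSpan C r (γ + ((M + 1 : ℤ) : Cbar C)) W
    push_cast
    rwa [← add_assoc]
  have hNroot : P.eval (γ + ((N - 1 : ℤ) : Cbar C)) = 0 := by
    refine hchange _ fun hiff => ?_
    have hN1 : N - 1 ∉ B := fun h => by
      have := hN.2 h (by omega)
      omega
    have he : γ + ((N - 1 : ℤ) : Cbar C) + 1 = γ + (N : Cbar C) := by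
      push_cast
      ring
    rw [he] at hiff
    exact hN1 fun h => hN.1 (hiff.mpr h)
  clear_value P
  obtain ⟨s, t, hst⟩ := hsf (M - (N - 1)) (by omega)
  have := congrArg (Polynomial.eval (γ + ((N - 1 : ℤ) : Cbar C))) hst
  have he : γ + ((N - 1 : ℤ) : Cbar C) + ((M - (N - 1) : ℤ) : Cbar C) = γ + (M : Cbar C) := by
    push_cast
    ring
  rw [Polynomial.eval_add, Polynomial.eval_mul, Polynomial.eval_mul, Polynomial.eval_comp,
    Polynomial.eval_add, Polynomial.eval_X, Polynomial.eval_C, he, hMroot, hNroot] at this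
  simp at this

/-- A polynomial dividing all `e * c i` divides `e` if it has no common factor with the `c i`. -/
lemma dvd_of_forall_dvd_mul {ι : Type*} {u e : Polynomial C} {c : ι → Polynomial C}
    (hgcd : ∀ d : Polynomial C, d ∣ u → (∀ i, d ∣ c i) → IsUnit d) (h : ∀ i, u ∣ e * c i) :
    u ∣ e := by
  let J : Ideal (Polynomial C) := Ideal.span (insert u (Set.range c))
  have hgen : ∀ x, x ∈ J ↔ Submodule.IsPrincipal.generator J ∣ x :=
    fun x => Submodule.IsPrincipal.mem_iff_generator_dvd J
  have hunit : IsUnit (Submodule.IsPrincipal.generator J) :=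
    hgcd _ ((hgen _).mp (Ideal.subset_span (Set.mem_insert _ _)))
      fun i => (hgen _).mp (Ideal.subset_span (Set.mem_insert_of_mem _ ⟨i, rfl⟩))
  have h1 : (1 : Polynomial C) ∈ J := (hgen 1).mpr hunit.dvd
  have hle : J ≤ Submodule.comap (LinearMap.mulLeft (Polynomial C) e) (Ideal.span {u}) := by
    refine Ideal.span_le.mpr ?_
    rintro x (rfl | ⟨i, rfl⟩)
    · exact Ideal.mem_span_singleton.mpr (Dvd.intro_left e rfl)
    · exact Ideal.mem_span_singleton.mpr (h i)
  simpa [Ideal.mem_span_singleton] using hle h1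

end Helpers

theorem statement14 [NeZero r] (hr : 1 ≤ r) (hℓ : ℓ 0 * ℓ r ≠ 0) {I : ℕ}
    (D : SuitableData C ℓ r I) (W : Fin r → (Fin r → RatFunc C))
    (hW : IsSuitableBasis C ℓ r D W)
    (e : Polynomial C) (M : Matrix (Fin r) (Fin r) (Polynomial C)) (he : e ≠ 0)
    (hSW : ∀ i, Smap C ℓ r (W i) = ∑ j, (toRat C (M i j) / toRat C e) • W j)
    (hgcd : ∀ d : Polynomial C, d ∣ e → (∀ i j, d ∣ M i j) → IsUnit d)
    (c : Fin r → Polynomial C) (u : Polynomial C) (hu : u ≠ 0)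
    (hgcdc : ∀ d : Polynomial C, d ∣ u → (∀ i, d ∣ c i) → IsUnit d)
    (hsf : ShiftFree (u.map (algebraMap C (Cbar C)) * ∏ i, (X - Polynomial.C (D.β i))))
    (hsum : IsSummable C ℓ r ((toRat C u)⁻¹ • ∑ i, toRat C (c i) • W i)) :
    u ∣ e ∧ ∃ b : Fin r → Polynomial C,
      (toRat C u)⁻¹ • ∑ i, toRat C (c i) • W i
        = Dmap C ℓ r (∑ i, toRat C (b i) • W i) := by
  obtain ⟨g, hg⟩ := hsum
  have hgW : g ∈ Submodule.span (RatFunc C) (Set.range W) := hW.1.2 ▸ Submodule.mem_top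
  obtain ⟨a, rfl⟩ := (Submodule.mem_span_range_iff_exists_fun (RatFunc C)).mp hgW
  have hmem := mem_localSpan_of_shiftFree hr hℓ hW hsf (a := a) fun γ hγ => by
    rw [← hg, Finset.smul_sum]
    exact ⟨fun i => (toRat C u)⁻¹ * toRat C (c i),
      fun i => (inLocalRing_inv_toRat hγ).mul (inLocalRing_toRat γ _), by simp [mul_smul]⟩
  have hpoly : ∀ i, ∃ p : Polynomial C, a i = toRat C p := fun i =>
    exists_polynomial_of_inLocalRing fun γ => (mem_localSpan_iff hW.1.1 a).mp (hmem γ) i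
  choose b hb using hpoly
  obtain rfl : a = fun i => toRat C (b i) := funext hb
  refine ⟨dvd_of_forall_dvd_mul hgcdc fun j => ?_, b, hg⟩
  have hu0 : toRat C u ≠ 0 := by simpa using hu
  have he0 : toRat C e ≠ 0 := by simpa using he
  have hcoord : (toRat C u)⁻¹ * toRat C (c j) =
      ∑ i, toRat C (polyσ C (b i)) * (toRat C (M i j) / toRat C e) - toRat C (b j) := by
    refine congrFun (hW.1.1.fintypeLinearCombination_injective
      (a₁ := fun j => (toRat C u)⁻¹ * toRat C (c j))
      (a₂ := fun j => ∑ i, toRat C (polyσ C (b i)) * (toRat C (M i j) / toRat C e) -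
        toRat C (b j)) ?_) j
    simp only [Fintype.linearCombination_apply, mul_smul, sub_smul, Finset.sum_smul,
      Finset.sum_sub_distrib, ← Finset.smul_sum]
    rw [hg, Dmap, Smap_sum_smul, Finset.sum_comm]
    simp only [hSW, ratσ_toRat, Finset.smul_sum]
  refine ⟨∑ i, polyσ C (b i) * M i j - e * b j, IsFractionRing.injective _ (RatFunc C) ?_⟩
  have h2 : toRat C e * toRat C (c j) = toRat C u *
      (∑ i, toRat C (polyσ C (b i)) * toRat C (M i j) - toRat C e * toRat C (b j)) := by
    simp only [← mul_div_assoc, ← Finset.sum_div] at hcoord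
    field_simp at hcoord
    linear_combination hcoord
  simpa only [map_mul, map_sub, map_sum] using h2

end PRec
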